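/- arXiv:2206.04260 — 2 statements merged into one kernel-verified Lean document; each statement's English description precedes it below -/
import Mathlib

section
/- For any integer n ≥ 3, any set of C(n-1,2)+2 points in the plane in general position (no three collinear, no two sharing an x-coordinate) contains either a 4-cap or the vertex set of a convex n-gon. -/
/-- `p q r` (in increasing `x`-coordinate) form a cap: `r` lies strictly below the
line `pq`, i.e. the slope decreases. -/
def GeomCap3 (p q r : ℝ × ℝ) : Prop :=
  (q.1 - p.1) * (r.2 - q.2) - (r.1 - q.1) * (q.2 - p.2) < 0


/-- Laced paths: built from a point by prepending `L` edges and appending non-`L` edges. -/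
inductive Lac {V : Type} [LinearOrder V] (L : V → V → Prop) (P : Finset V) : V → V → ℕ → Prop
  | single (x : V) (hx : x ∈ P) : Lac L P x x 1
  | consL (w x y : V) (k : ℕ) (hw : w ∈ P) (hwx : w < x) (hL : L w x) (h : Lac L P x y k) :
      Lac L P w y (k + 1)
  | snocR (x y z : V) (k : ℕ) (hz : z ∈ P) (hyz : y < z) (hR : ¬ L y z) (h : Lac L P x y k) :
      Lac L P x z (k + 1)

def LGood {V : Type} [LinearOrder V] (L : V → V → Prop) (P : Finset V) (m : ℕ) (r s : V) : Prop :=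
  Lac L P r s m ∧ ∃ x y a b, Lac L P x r a ∧ Lac L P s y b ∧ m ≤ a + b

def LNo {V : Type} [LinearOrder V] (L : V → V → Prop) (P : Finset V) (m : ℕ) : Prop :=
  ∀ x y k, Lac L P x y k → k ≤ m

section coloring
variable {V : Type} [LinearOrder V]

lemma Lac.mono {L : V → V → Prop} {P Q : Finset V} (h : P ⊆ Q) {x y : V} {k : ℕ}
    (hl : Lac L P x y k) : Lac L Q x y k := by
  induction hl with
  | single x hx => exact .single x (h hx)
  | consL w x y k hw hwx hL _ ih => exact .consL w x y k (h hw) hwx hL ih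
  | snocR x y z k hz hyz hR _ ih => exact .snocR x y z k (h hz) hyz hR ih

lemma Lac.mem {L : V → V → Prop} {P : Finset V} {x y : V} {k : ℕ}
    (hl : Lac L P x y k) : x ∈ P ∧ y ∈ P := by
  induction hl with
  | single x hx => exact ⟨hx, hx⟩
  | consL w x y k hw hwx hL _ ih => exact ⟨hw, ih.2⟩
  | snocR x y z k hz hyz hR _ ih => exact ⟨ih.1, hz⟩

lemma LGood.mono {L : V → V → Prop} {P Q : Finset V} (h : P ⊆ Q) {r s : V} {m : ℕ}
    (hl : LGood L P m r s) : LGood L Q m r s := by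
  obtain ⟨h1, x, y, a, b, h2, h3, h4⟩ := hl
  exact ⟨h1.mono h, x, y, a, b, h2.mono h, h3.mono h, h4⟩

lemma LNo.mono {L : V → V → Prop} {P Q : Finset V} (h : P ⊆ Q) {m : ℕ}
    (hl : LNo L Q m) : LNo L P m := fun x y k hk => hl x y k (hk.mono h)

lemma many_ends {L : V → V → Prop} {m : ℕ}
    (ih : ∀ P : Finset V, LNo L P m → m.choose 2 + 1 ≤ P.card → ∃ r s, LGood L P m r s)
    (P : Finset V) (hno : LNo L P m) (c : ℕ) (hc : m.choose 2 + c ≤ P.card) :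
    ∃ E ⊆ P, E.card = c ∧ ∀ s ∈ E, ∃ r, LGood L P m r s := by
  induction c with
  | zero => exact ⟨∅, by simp, by simp, by simp⟩
  | succ c ihc =>
    obtain ⟨E, hE, hEc, hEg⟩ := ihc (by omega)
    have h1 := Finset.card_sdiff_add_card_eq_card hE
    obtain ⟨r, s, hg⟩ := ih (P \ E) (hno.mono Finset.sdiff_subset) (by omega)
    have hs := hg.1.mem.2
    rw [Finset.mem_sdiff] at hs
    refine ⟨insert s E, ?_, ?_, ?_⟩
    · intro z hz
      rcases Finset.mem_insert.1 hz with rfl | hz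
      · exact hs.1
      · exact hE hz
    · rw [Finset.card_insert_of_notMem hs.2, hEc]
    · intro z hz
      rcases Finset.mem_insert.1 hz with rfl | hz
      · exact ⟨r, hg.mono Finset.sdiff_subset⟩
      · exact hEg z hz

open Classical in
lemma one_side {L : V → V → Prop} {m : ℕ}
    (ih : ∀ P : Finset V, LNo L P m → m.choose 2 + 1 ≤ P.card → ∃ r s, LGood L P m r s)
    (P : Finset V) (hno : LNo L P (m + 1)) (hc : (m + 1).choose 2 + 1 ≤ P.card) :
    (∃ r s, LGood L P (m + 1) r s) ∨
      ∃ v ∈ P, (∀ y ∈ P, v < y → L v y) ∧ ∃ e, Lac L P v e (m + 1) := by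
  by_contra! hcon
  obtain ⟨hbad, hex⟩ := hcon
  set T := P.filter (fun q => ∀ y ∈ P, q < y → L q y) with hT
  have hTP : T ⊆ P := Finset.filter_subset _ _
  have hR : ∀ s ∈ P \ T, ∃ z ∈ P, s < z ∧ ¬ L s z := by
    intro s hs
    by_contra! hcon
    rw [Finset.mem_sdiff] at hs
    exact hs.2 (Finset.mem_filter.2 ⟨hs.1, hcon⟩)
  have hno' : LNo L (P \ T) m := by
    intro x y k hk
    obtain ⟨z, hz, hyz, hL⟩ := hR y hk.mem.2
    have := hno _ _ _ (Lac.snocR x y z k hz hyz hL (hk.mono Finset.sdiff_subset))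
    omega
  have hch : (m + 1).choose 2 = m.choose 2 + m := by
    rw [Nat.choose_succ_succ' m 1]; simp [add_comm]
  have h1 := Finset.card_sdiff_add_card_eq_card hTP
  obtain ⟨E, hE, hEc, hEg⟩ : ∃ E ⊆ P \ T, E.card = m + 1 - T.card ∧
      ∀ s ∈ E, ∃ r, LGood L (P \ T) m r s := by
    by_cases hτ : T.card ≤ m
    · exact many_ends ih _ hno' _ (by omega)
    · exact ⟨∅, by simp, by simp; omega, by simp⟩
  -- data for the ends
  have hEd : ∀ s ∈ E, ∃ r x y a b, Lac L P r s m ∧ Lac L P x r a ∧ Lac L P s y b ∧ m + 1 ≤ a + b := by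
    intro s hs
    obtain ⟨r, h1, x, y, a, b, h2, h3, h4⟩ := hEg s hs
    obtain ⟨z, hz, hyz, hL⟩ := hR y h3.mem.2
    exact ⟨r, x, z, a, b + 1, h1.mono Finset.sdiff_subset, h2.mono Finset.sdiff_subset,
      Lac.snocR s y z b hz hyz hL (h3.mono Finset.sdiff_subset), by omega⟩
  set M := T ∪ E with hM
  have hMP : M ⊆ P := Finset.union_subset hTP (hE.trans Finset.sdiff_subset)
  have hMc : m + 1 ≤ M.card := by
    rw [hM, Finset.card_union_of_disjoint]
    · omega
    · exact Finset.disjoint_of_subset_right hE Finset.disjoint_sdiff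
  -- downward claim
  have key : ∀ k, ∀ p ∈ M, (M.filter (fun q => p < q)).card = k →
      ∃ e b, Lac L P p e b ∧ m + 1 ≤ b + (M.filter (fun q => q < p)).card := by
    intro k
    induction k with
    | zero =>
      intro p hp h0
      refine ⟨p, 1, .single p (hMP hp), ?_⟩
      have : M ⊆ insert p (M.filter (fun q => q < p)) := by
        intro q hq
        rw [Finset.card_eq_zero, Finset.filter_eq_empty_iff] at h0
        rcases lt_trichotomy q p with h | h | h
        · exact Finset.mem_insert_of_mem (Finset.mem_filter.2 ⟨hq, h⟩)
        · simp [h]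
        · exact absurd h (h0 hq)
      have := Finset.card_le_card this
      have := Finset.card_insert_le p (M.filter (fun q => q < p))
      omega
    | succ k ihk =>
      intro p hp h0
      have hne : (M.filter (fun q => p < q)).Nonempty := by
        rw [← Finset.card_pos]; omega
      set p' := (M.filter (fun q => p < q)).min' hne with hp'
      have hp'm := Finset.min'_mem _ hne
      rw [← hp', Finset.mem_filter] at hp'm
      have hmin : ∀ q ∈ M, p < q → p' ≤ q := fun q hq hpq =>
        Finset.min'_le _ _ (Finset.mem_filter.2 ⟨hq, hpq⟩)
      have hup : M.filter (fun q => p < q) = insert p' (M.filter (fun q => p' < q)) := by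
        ext q
        simp only [Finset.mem_filter, Finset.mem_insert]
        constructor
        · rintro ⟨hq, hpq⟩
          rcases (hmin q hq hpq).lt_or_eq with h | h
          · exact .inr ⟨hq, h⟩
          · exact .inl h.symm
        · rintro (h | ⟨hq, h⟩)
          · rw [h]; exact hp'm
          · exact ⟨hq, hp'm.2.trans h⟩
      have hlo : M.filter (fun q => q < p') = insert p (M.filter (fun q => q < p)) := by
        ext q
        simp only [Finset.mem_filter, Finset.mem_insert]
        constructor
        · rintro ⟨hq, hpq⟩
          rcases lt_trichotomy q p with h | h | h
          · exact .inr ⟨hq, h⟩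
          · exact .inl h
          · exact absurd hpq (not_lt.2 (hmin q hq h))
        · rintro (h | ⟨hq, h⟩)
          · rw [h]; exact ⟨hp, hp'm.2⟩
          · exact ⟨hq, h.trans hp'm.2⟩
      rw [hup, Finset.card_insert_of_notMem (by simp)] at h0
      obtain ⟨e, b, hl, hb⟩ := ihk p' hp'm.1 (by omega)
      rw [hlo, Finset.card_insert_of_notMem (by simp)] at hb
      by_cases hLp : L p p'
      · exact ⟨e, b + 1, .consL p p' e b (hMP hp) hp'm.2 hLp hl, by omega⟩
      · rcases Finset.mem_union.1 hp with hpT | hpE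
        · exact absurd ((Finset.mem_filter.1 hpT).2 p' (hMP hp'm.1) hp'm.2) hLp
        · obtain ⟨r, x, y, a, b', h1, h2, h3, h4⟩ := hEd p hpE
          refine ⟨y, b', h3, ?_⟩
          by_contra hlt
          exact hbad r p' ⟨.snocR r p p' m (hMP hp'm.1) hp'm.2 hLp h1, x, e, a, b, h2, hl, by omega⟩
  have hMne : M.Nonempty := by rw [← Finset.card_pos]; omega
  set p := M.min' hMne with hp
  have hpM : p ∈ M := Finset.min'_mem _ hMne
  obtain ⟨e, b, hl, hb⟩ := key _ p hpM rfl
  have hz : M.filter (fun q => q < p) = ∅ := by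
    rw [Finset.filter_eq_empty_iff]
    intro q hq
    exact not_lt.2 (Finset.min'_le _ _ hq)
  rw [hz, Finset.card_empty] at hb
  have hb' := hno _ _ _ hl
  obtain rfl : b = m + 1 := by omega
  rcases Finset.mem_union.1 hpM with hpT | hpE
  · exact hex p (hMP hpM) (Finset.mem_filter.1 hpT).2 e hl
  · obtain ⟨r, x, y, a, b', h1, h2, h3, h4⟩ := hEd p hpE
    exact hbad p e ⟨hl, r, e, m, 1, h1, .single e hl.mem.2, le_rfl⟩

/-- mirrored labelling -/
def mirL (L : V → V → Prop) : Vᵒᵈ → Vᵒᵈ → Prop :=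
  fun x y => ¬ L (OrderDual.ofDual y) (OrderDual.ofDual x)

def mirP (P : Finset V) : Finset Vᵒᵈ := P.map OrderDual.toDual.toEmbedding

lemma mem_mirP {P : Finset V} {x : Vᵒᵈ} : x ∈ mirP P ↔ OrderDual.ofDual x ∈ P := by
  simp [mirP]

lemma Lac.mir {L : V → V → Prop} {P : Finset V} {x y : V} {k : ℕ} (h : Lac L P x y k) :
    Lac (mirL L) (mirP P) (OrderDual.toDual y) (OrderDual.toDual x) k := by
  induction h with
  | single x hx => exact .single _ (mem_mirP.2 hx)
  | consL w x y k hw hwx hL _ ih =>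
    exact .snocR _ _ _ _ (mem_mirP.2 hw) hwx (not_not.2 hL) ih
  | snocR x y z k hz hyz hR _ ih =>
    exact .consL _ _ _ _ (mem_mirP.2 hz) hyz hR ih

lemma Lac.unmir {L : V → V → Prop} {P : Finset V} {x y : Vᵒᵈ} {k : ℕ}
    (h : Lac (mirL L) (mirP P) x y k) :
    Lac L P (OrderDual.ofDual y) (OrderDual.ofDual x) k := by
  induction h with
  | single x hx => exact .single _ (mem_mirP.1 hx)
  | consL w x y k hw hwx hL _ ih =>
    exact .snocR _ _ _ _ (mem_mirP.1 hw) hwx hL ih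
  | snocR x y z k hz hyz hR _ ih =>
    exact .consL _ _ _ _ (mem_mirP.1 hz) hyz (not_not.1 hR) ih

lemma LGood.mir {L : V → V → Prop} {P : Finset V} {r s : V} {m : ℕ}
    (h : LGood L P m r s) :
    LGood (mirL L) (mirP P) m (OrderDual.toDual s) (OrderDual.toDual r) := by
  obtain ⟨h1, x, y, a, b, h2, h3, h4⟩ := h
  exact ⟨h1.mir, _, _, b, a, h3.mir, h2.mir, by omega⟩

lemma LGood.unmir {L : V → V → Prop} {P : Finset V} {r s : Vᵒᵈ} {m : ℕ}
    (h : LGood (mirL L) (mirP P) m r s) :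
    LGood L P m (OrderDual.ofDual s) (OrderDual.ofDual r) := by
  obtain ⟨h1, x, y, a, b, h2, h3, h4⟩ := h
  exact ⟨h1.unmir, _, _, b, a, h3.unmir, h2.unmir, by omega⟩

lemma LNo.mir {L : V → V → Prop} {P : Finset V} {m : ℕ} (h : LNo L P m) :
    LNo (mirL L) (mirP P) m := fun _ _ _ hk => h _ _ _ hk.unmir

lemma card_mirP (P : Finset V) : (mirP P).card = P.card := Finset.card_map _

theorem exists_good {L : V → V → Prop} (m : ℕ) :
    ∀ P : Finset V, LNo L P m → m.choose 2 + 1 ≤ P.card → ∃ r s, LGood L P m r s := by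
  induction m with
  | zero =>
    intro P hno hc
    obtain ⟨x, hx⟩ : P.Nonempty := by rw [← Finset.card_pos]; omega
    have := hno _ _ _ (Lac.single x hx)
    omega
  | succ m ih =>
    intro P hno hc
    rcases one_side ih P hno hc with h | ⟨v, hv, hvL, e, hve⟩
    · exact h
    have ih' : ∀ Q : Finset Vᵒᵈ, LNo (mirL L) Q m → m.choose 2 + 1 ≤ Q.card →
        ∃ r s, LGood (mirL L) Q m r s := by
      intro Q hQ hQc
      obtain ⟨Q', rfl⟩ : ∃ Q' : Finset V, Q = mirP Q' :=
        ⟨Q.map OrderDual.ofDual.toEmbedding, by ext; simp [mem_mirP]⟩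
      obtain ⟨r, s, h⟩ := ih Q' (fun x y k hk => hQ _ _ _ hk.mir) (by rwa [card_mirP] at hQc)
      exact ⟨_, _, h.mir⟩
    rcases one_side ih' (mirP P) hno.mir (by rwa [card_mirP]) with ⟨r, s, h⟩ | ⟨w, hw, hwL, e', hwe⟩
    · exact ⟨_, _, h.unmir⟩
    have hwe' := hwe.unmir
    set w' := OrderDual.ofDual w with hw'
    have hwR : ∀ y ∈ P, y < w' → ¬ L y w' := fun y hy hyw =>
      hwL (OrderDual.toDual y) (mem_mirP.2 hy) hyw
    have hwP : w' ∈ P := mem_mirP.1 hw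
    rcases lt_trichotomy v w' with h | h | h
    · exact absurd (hvL w' hwP h) (hwR v hv h)
    · rw [← h] at hwe'
      exact ⟨v, e, hve, _, e, m + 1, 1, hwe', .single e hve.mem.2, by omega⟩
    · by_cases hL : L w' v
      · have := hno _ _ _ (Lac.consL w' v e _ hwP h hL hve)
        omega
      · have := hno _ _ _ (Lac.snocR _ w' v _ hv h hL hwe')
        omega

end coloring

section cups
variable {V : Type} [LinearOrder V]

def CupSet (cup : V → V → V → Prop) (C : Finset V) : Prop :=
  ∀ x ∈ C, ∀ y ∈ C, ∀ z ∈ C, x < y → y < z → cup x y z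

def CupTrans (cup : V → V → V → Prop) : Prop :=
  ∀ i j k l, i < j → j < k → k < l → cup i j k → cup j k l → cup i j l ∧ cup i k l

/-- `A` ends at `r`, `B` starts at `s`. -/
lemma CupSet.join {cup : V → V → V → Prop} (ht : CupTrans cup) {A B : Finset V} {r s : V}
    (hA : CupSet cup A) (hB : CupSet cup B) (hrs : r < s)
    (hr : r ∈ A) (hs : s ∈ B)
    (hAr : ∀ x ∈ A, x ≤ r) (hBs : ∀ y ∈ B, s ≤ y)
    (h1 : ∀ x ∈ A, x < r → cup x r s) (h2 : ∀ y ∈ B, s < y → cup r s y) :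
    CupSet cup (A ∪ B) := by
  have a1 : ∀ x ∈ A, x < r → ∀ b ∈ B, cup x r b := by
    intro x hx hxr b hb
    rcases (hBs b hb).lt_or_eq with h | h
    · exact (ht x r s b hxr hrs h (h1 x hx hxr) (h2 b hb h)).1
    · rw [← h]; exact h1 x hx hxr
  have a2 : ∀ a ∈ A, ∀ y ∈ B, s < y → cup a s y := by
    intro a ha y hy hsy
    rcases (hAr a ha).lt_or_eq with h | h
    · exact (ht a r s y h hrs hsy (h1 a ha h) (h2 y hy hsy)).2
    · rw [h]; exact h2 y hy hsy
  intro x hx y hy z hz hxy hyz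
  rcases Finset.mem_union.1 hz with hz | hz
  · -- all in A
    have hyA : y ∈ A := by
      rcases Finset.mem_union.1 hy with h | h
      · exact h
      · exact absurd (hrs.trans_le (hBs y h)) (not_lt.2 ((hyz.le).trans (hAr z hz)))
    have hxA : x ∈ A := by
      rcases Finset.mem_union.1 hx with h | h
      · exact h
      · exact absurd (hrs.trans_le (hBs x h)) (not_lt.2 ((hxy.le).trans (hAr y hyA)))
    exact hA x hxA y hyA z hz hxy hyz
  · rcases Finset.mem_union.1 hy with hy | hy
    · have hxA : x ∈ A := by
        rcases Finset.mem_union.1 hx with h | h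
        · exact h
        · exact absurd (hrs.trans_le (hBs x h)) (not_lt.2 ((hxy.le).trans (hAr y hy)))
      rcases (hAr y hy).lt_or_eq with h | h
      · exact (ht x y r z hxy h (hrs.trans_le (hBs z hz)) (hA x hxA y hy r hr hxy h)
          (a1 y hy h z hz)).1
      · rw [h]; exact a1 x hxA (h ▸ hxy) z hz
    · rcases Finset.mem_union.1 hx with hx | hx
      · rcases (hBs y hy).lt_or_eq with h | h
        · exact (ht x s y z ((hAr x hx).trans_lt hrs) h hyz (a2 x hx y hy h)
            (hB s hs y hy z hz h hyz)).2
        · rw [← h]; exact a2 x hx z hz (h ▸ hyz)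
      · exact hB x hx y hy z hz hxy hyz

lemma CupSet.single {cup : V → V → V → Prop} (x : V) : CupSet cup {x} := by
  intro a ha b hb c hc h1 h2
  simp at ha hb hc
  subst ha hb
  exact absurd h1 (lt_irrefl _)

def labL (cup : V → V → V → Prop) (X : Finset V) (x y : V) : Prop :=
  ∀ z ∈ X, y < z → cup x y z

def NoCap4 (cup : V → V → V → Prop) (X : Finset V) : Prop :=
  ∀ i ∈ X, ∀ j ∈ X, ∀ k ∈ X, ∀ l ∈ X, i < j → j < k → k < l → cup i j k ∨ cup j k l

lemma labR {cup : V → V → V → Prop} {X : Finset V} (h4 : NoCap4 cup X) {x y : V}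
    (hx : x ∈ X) (hy : y ∈ X) (hxy : x < y)
    (h : ¬ labL cup X x y) : ∀ w ∈ X, w < x → cup w x y := by
  intro w hw hwx
  unfold labL at h
  push Not at h
  obtain ⟨z, hz, hyz, hc⟩ := h
  exact (h4 w hw x hx y hy z hz hwx hxy hyz).resolve_right hc

def IsCup (cup : V → V → V → Prop) (X C : Finset V) (x y : V) : Prop :=
  C ⊆ X ∧ CupSet cup C ∧ x ∈ C ∧ y ∈ C ∧ ∀ z ∈ C, x ≤ z ∧ z ≤ y

/-- join of two cups -/
lemma IsCup.join {cup : V → V → V → Prop} (ht : CupTrans cup) {X A B : Finset V} {p r s q : V}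
    (hA : IsCup cup X A p r) (hB : IsCup cup X B s q) (hrs : r < s)
    (h1 : ∀ x ∈ A, x < r → cup x r s) (h2 : ∀ y ∈ B, s < y → cup r s y) :
    IsCup cup X (A ∪ B) p q ∧ (A ∪ B).card = A.card + B.card := by
  obtain ⟨a1, a2, a3, a4, a5⟩ := hA
  obtain ⟨b1, b2, b3, b4, b5⟩ := hB
  refine ⟨⟨Finset.union_subset a1 b1, a2.join ht b2 hrs a4 b3 (fun x hx => (a5 x hx).2)
    (fun x hx => (b5 x hx).1) h1 h2, Finset.mem_union_left _ a3, Finset.mem_union_right _ b4, ?_⟩, ?_⟩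
  · intro z hz
    rcases Finset.mem_union.1 hz with h | h
    · exact ⟨(a5 z h).1, (a5 z h).2.trans (hrs.le.trans (b5 q b4).1)⟩
    · exact ⟨(a5 p a3).2.trans (hrs.le.trans (b5 z h).1), (b5 z h).2⟩
  · apply Finset.card_union_of_disjoint
    rw [Finset.disjoint_left]
    intro z hz hz'
    exact absurd (((b5 z hz').1).trans (a5 z hz).2) (not_le.2 hrs)

lemma IsCup.single {cup : V → V → V → Prop} {X : Finset V} {x : V} (hx : x ∈ X) :
    IsCup cup X {x} x x :=
  ⟨by simpa using hx, CupSet.single x, by simp, by simp, by simp⟩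

lemma IsCup.snoc {cup : V → V → V → Prop} (ht : CupTrans cup) {X A : Finset V} {p r s : V}
    (hA : IsCup cup X A p r) (hs : s ∈ X) (hrs : r < s)
    (h1 : ∀ x ∈ A, x < r → cup x r s) :
    IsCup cup X (A ∪ {s}) p s ∧ (A ∪ {s}).card = A.card + 1 := by
  have := hA.join ht (IsCup.single hs) hrs h1
    (fun y hy h => absurd h (by rw [Finset.mem_singleton] at hy; rw [hy]; exact lt_irrefl _))
  simpa using this

lemma IsCup.cons {cup : V → V → V → Prop} (ht : CupTrans cup) {X B : Finset V} {r s q : V}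
    (hB : IsCup cup X B s q) (hr : r ∈ X) (hrs : r < s)
    (h2 : ∀ y ∈ B, s < y → cup r s y) :
    IsCup cup X ({r} ∪ B) r q ∧ ({r} ∪ B).card = B.card + 1 := by
  have := (IsCup.single hr).join ht hB hrs
    (fun y hy h => absurd h (by rw [Finset.mem_singleton] at hy; rw [hy]; exact lt_irrefl _)) h2
  rw [add_comm]
  simpa using this

lemma Lac.isCup {cup : V → V → V → Prop} (ht : CupTrans cup) {X : Finset V}
    (h4 : NoCap4 cup X) {x y : V} {k : ℕ} (h : Lac (labL cup X) X x y k) :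
    ∃ C, IsCup cup X C x y ∧ C.card = k := by
  induction h with
  | single x hx => exact ⟨{x}, IsCup.single hx, by simp⟩
  | consL w x y k hw hwx hL h ih =>
    obtain ⟨C, hC, rfl⟩ := ih
    exact ⟨_, hC.cons ht hw hwx (fun y hy h => hL y (hC.1 hy) h)⟩
  | snocR x y z k hz hyz hR h ih =>
    obtain ⟨C, hC, rfl⟩ := ih
    exact ⟨_, hC.snoc ht hz hyz (fun x hx h => labR h4 (hC.1 hC.2.2.2.1) hz hyz hR x (hC.1 hx) h)⟩

/-- The abstract form of a convex `(m+1)`-gon. -/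
def HasGon (cup : V → V → V → Prop) (X : Finset V) (m : ℕ) : Prop :=
  (∃ C ⊆ X, CupSet cup C ∧ m + 1 ≤ C.card) ∨
  ∃ C r s t, IsCup cup X C r s ∧ C.card = m ∧ t ∈ X ∧ r < t ∧ t < s ∧ ¬ cup r t s

lemma gon_of_RL {cup : V → V → V → Prop} (ht : CupTrans cup) {X : Finset V}
    (h4 : NoCap4 cup X) {m : ℕ} {r s t : V} (hg : LGood (labL cup X) X m r s)
    (htX : t ∈ X) (hrt : r < t) (hts : t < s) (hR : ¬ labL cup X r t) (hL : labL cup X t s) :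
    HasGon cup X m := by
  obtain ⟨h1, x, y, a, b, h2, h3, h4'⟩ := hg
  by_cases hc : cup r t s
  · left
    obtain ⟨A, hA, rfl⟩ := h2.isCup ht h4
    obtain ⟨B, hB, rfl⟩ := h3.isCup ht h4
    have e1 : ∀ x ∈ A, x < r → cup x r t := fun x hx h =>
      labR h4 h1.mem.1 htX hrt hR x (hA.1 hx) h
    obtain ⟨hA', hc'⟩ := hA.snoc ht htX hrt e1
    obtain ⟨hj, hjc⟩ := hA'.join ht hB hts (by
      intro x hx hxt
      rcases Finset.mem_union.1 hx with h | h
      · rcases (hA.2.2.2.2 x h).2.lt_or_eq with h' | h'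
        · exact (ht x r t s h' hrt hts (e1 x h h') hc).2
        · rw [h']; exact hc
      · rw [Finset.mem_singleton] at h
        exact absurd hxt (by rw [h]; exact lt_irrefl _)) (fun y hy h => hL y (hB.1 hy) h)
    exact ⟨_, hj.1, hj.2.1, by omega⟩
  · right
    obtain ⟨C, hC, hCc⟩ := h1.isCup ht h4
    exact ⟨C, r, s, t, hC, hCc, htX, hrt, hts, hc⟩

lemma gon_of_two {cup : V → V → V → Prop} (ht : CupTrans cup) {X : Finset V}
    (h4 : NoCap4 cup X) {m : ℕ} (hno : LNo (labL cup X) X m)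
    (hSD : ∀ v a b, Lac (labL cup X) X a v m → Lac (labL cup X) X v b m → False)
    {r s r' s' : V} (hg : LGood (labL cup X) X m r s) (hg' : LGood (labL cup X) X m r' s')
    (hr : r < r') (hs : s ≠ s') : HasGon cup X m := by
  have hrX := hg.1.mem.1
  have hsX := hg.1.mem.2
  have hr'X := hg'.1.mem.1
  have hs'X := hg'.1.mem.2
  have hS : ∀ v b, Lac (labL cup X) X v b m → ∀ x ∈ X, x < v → ¬ labL cup X x v := by
    intro v b hv x hx hxv hL
    have := hno _ _ _ (Lac.consL x v b m hx hxv hL hv)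
    omega
  have hD : ∀ v a, Lac (labL cup X) X a v m → ∀ y ∈ X, v < y → labL cup X v y := by
    intro v b hv y hy hvy
    by_contra hL
    have := hno _ _ _ (Lac.snocR b v y m hy hvy hL hv)
    omega
  have hlt : ∀ v b w a, Lac (labL cup X) X v b m → Lac (labL cup X) X a w m → v < w := by
    intro v b w a hv hw
    rcases lt_trichotomy v w with h | h | h
    · exact h
    · subst h; exact (hSD v a b hw hv).elim
    · exact absurd (hD w a hw v hv.mem.1 h) (hS v b hv w hw.mem.2 h)
  have hR : ¬ labL cup X r r' := hS r' s' hg'.1 r hrX hr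
  have h1 : r' < s := hlt _ _ _ _ hg'.1 hg.1
  have h2 : r' < s' := hlt _ _ _ _ hg'.1 hg'.1
  rcases lt_or_gt_of_ne hs with hss | hss
  · have hL : labL cup X s s' := hD s r hg.1 s' hs'X hss
    by_cases h : labL cup X r' s
    · exact gon_of_RL ht h4 hg hr'X hr h1 hR h
    · exact gon_of_RL ht h4 hg' hsX h1 hss h hL
  · -- nested case
    have hL : labL cup X s' s := hD s' r' hg'.1 s hsX hss
    by_cases k1 : labL cup X r' s
    · exact gon_of_RL ht h4 hg hr'X hr h1 hR k1
    by_cases k2 : labL cup X r s'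
    swap
    · exact gon_of_RL ht h4 hg hs'X (hr.trans h2) hss k2 hL
    obtain ⟨-, x, y, a, b, hx, hy, hab⟩ := hg
    obtain ⟨A, hA, rfl⟩ := hx.isCup ht h4
    obtain ⟨B, hB, rfl⟩ := hy.isCup ht h4
    by_cases c1 : ∀ x ∈ A, x < r → cup x r s'
    · left
      obtain ⟨hA', hc'⟩ := hA.snoc ht hs'X (hr.trans h2) c1
      have hc : cup r s' s := k2 s hsX hss
      obtain ⟨hj, hjc⟩ := hA'.join ht hB hss (by
        intro x hx hxt
        rcases Finset.mem_union.1 hx with h | h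
        · rcases (hA.2.2.2.2 x h).2.lt_or_eq with h' | h'
          · exact (ht x r s' s h' (hr.trans h2) hss (c1 x h h') hc).2
          · rw [h']; exact hc
        · rw [Finset.mem_singleton] at h
          exact absurd hxt (by rw [h]; exact lt_irrefl _)) (fun y hy h => hL y (hB.1 hy) h)
      exact ⟨_, hj.1, hj.2.1, by omega⟩
    by_cases c2 : ∀ y ∈ B, s < y → cup r' s y
    · left
      obtain ⟨hB', hc'⟩ := hB.cons ht hr'X h1 c2
      have hc : cup r r' s := labR h4 hr'X hsX h1 k1 r hrX hr
      obtain ⟨hj, hjc⟩ := hA.join ht hB' hr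
        (fun x hx h => labR h4 hrX hr'X hr hR x (hA.1 hx) h) (by
        intro y hy hty
        rcases Finset.mem_union.1 hy with h | h
        · rw [Finset.mem_singleton] at h
          exact absurd hty (by rw [h]; exact lt_irrefl _)
        · rcases (hB.2.2.2.2 y h).1.lt_or_eq with h' | h'
          · exact (ht r r' s y hr h1 h' hc (c2 y h h')).1
          · rw [← h']; exact hc)
      exact ⟨_, hj.1, hj.2.1, by omega⟩
    push Not at c1 c2
    obtain ⟨x, hxA, hxr, hxc⟩ := c1
    obtain ⟨y, hyB, hsy, hyc⟩ := c2
    exfalso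
    rcases h4 r hrX r' hr'X s' hs'X s hsX hr h2 hss with h | h
    · exact hxc (ht x r r' s' hxr hr h2 (labR h4 hrX hr'X hr hR x (hA.1 hxA) hxr) h).1
    · exact hyc (ht r' s' s y h2 hss hsy h (hL y (hB.1 hyB) hsy)).2

theorem has_gon {cup : V → V → V → Prop} (ht : CupTrans cup) {X : Finset V}
    (h4 : NoCap4 cup X) {m : ℕ} (hm : m.choose 2 + 2 ≤ X.card) :
    HasGon cup X m := by
  by_cases hno : LNo (labL cup X) X m
  swap
  · unfold LNo at hno
    push Not at hno
    obtain ⟨x, y, k, hk, hmk⟩ := hno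
    obtain ⟨C, hC, rfl⟩ := hk.isCup ht h4
    exact .inl ⟨C, hC.1, hC.2.1, hmk⟩
  have del : ∀ v ∈ X, ∃ r s, LGood (labL cup X) X m r s ∧ r ≠ v ∧ s ≠ v := by
    intro v hv
    have hc := Finset.card_erase_of_mem hv
    obtain ⟨r, s, h⟩ := exists_good m (X.erase v) (hno.mono (Finset.erase_subset _ _)) (by omega)
    exact ⟨r, s, h.mono (Finset.erase_subset _ _), Finset.ne_of_mem_erase h.1.mem.1,
      Finset.ne_of_mem_erase h.1.mem.2⟩
  by_cases hSD : ∀ v a b, Lac (labL cup X) X a v m → Lac (labL cup X) X v b m → False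
  swap
  · push Not at hSD
    obtain ⟨v, a, b, hav, hvb, -⟩ := hSD
    have hvX := hav.mem.2
    obtain ⟨r, s, hg, hrv, hsv⟩ := del v hvX
    have e1 : ∀ x ∈ X, x < v → ¬ labL cup X x v := by
      intro x hx hxv hL
      have := hno _ _ _ (Lac.consL x v b m hx hxv hL hvb)
      omega
    have e2 : ∀ y ∈ X, v < y → labL cup X v y := by
      intro y hy hvy
      by_contra hL
      have := hno _ _ _ (Lac.snocR a v y m hy hvy hL hav)
      omega
    have hrX := hg.1.mem.1
    have hsX := hg.1.mem.2
    have hr : r < v := by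
      rcases lt_or_gt_of_ne hrv with h | h
      · exact h
      · have := hno _ _ _ (Lac.consL v r s m hvX h (e2 r hrX h) hg.1)
        omega
    have hs : v < s := by
      rcases lt_or_gt_of_ne hsv with h | h
      · have := hno _ _ _ (Lac.snocR r s v m hvX h (e1 s hsX h) hg.1)
        omega
      · exact h
    exact gon_of_RL ht h4 hg hvX hr hs (e1 r hrX hr) (e2 s hsX hs)
  have two : ∀ r s r' s', LGood (labL cup X) X m r s → LGood (labL cup X) X m r' s' →
      r ≠ r' → s ≠ s' → HasGon cup X m := by
    intro r s r' s' hg hg' hr hs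
    rcases lt_or_gt_of_ne hr with h | h
    · exact gon_of_two ht h4 hno hSD hg hg' h hs
    · exact gon_of_two ht h4 hno hSD hg' hg h hs.symm
  obtain ⟨r, s, hg⟩ := exists_good m X hno (by omega)
  obtain ⟨r2, s2, hg2, hr2, -⟩ := del r hg.1.mem.1
  by_cases hs2 : s2 = s
  · subst hs2
    obtain ⟨r3, s3, hg3, -, hs3⟩ := del s2 hg.1.mem.2
    by_cases hr3 : r3 = r
    · subst hr3
      exact two _ _ _ _ hg2 hg3 hr2 hs3.symm
    · exact two _ _ _ _ hg3 hg hr3 hs3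
  · exact two _ _ _ _ hg2 hg hr2 hs2

end cups

section geometry

def gcup (f : ℝ → ℝ) (x y z : ℝ) : Prop :=
  0 < (y - x) * (f z - f y) - (z - y) * (f y - f x)

lemma gcup_trans (f : ℝ → ℝ) : CupTrans (gcup f) := by
  intro i j k l hij hjk hkl h1 h2
  unfold gcup at *
  have ha : 0 < j - i := sub_pos.2 hij
  have hb : 0 < k - j := sub_pos.2 hjk
  have hc : 0 < l - k := sub_pos.2 hkl
  have key : 0 < (j - i) * (f l - f k) - (l - k) * (f j - f i) := by
    have h3 : 0 < (k - j) * ((j - i) * (f l - f k) - (l - k) * (f j - f i)) := by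
      have e1 := mul_pos ha h2
      have e2 := mul_pos hc h1
      nlinarith [e1, e2]
    exact (pos_iff_pos_of_mul_pos h3).1 hb
  constructor
  · nlinarith [key, h1]
  · nlinarith [key, h2]

lemma notMem_hull (T : Finset (ℝ × ℝ)) (p : ℝ × ℝ) (u v : ℝ)
    (h : ∀ q ∈ T, q ≠ p → u * p.1 + v * p.2 < u * q.1 + v * q.2) :
    p ∉ convexHull ℝ ((T.erase p : Finset (ℝ × ℝ)) : Set (ℝ × ℝ)) := by
  intro hp
  have hconv : Convex ℝ {q : ℝ × ℝ | u * p.1 + v * p.2 < u * q.1 + v * q.2} := by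
    intro a ha b hb s t hs ht hst
    simp only [Set.mem_ofPred_eq, Prod.fst_add, Prod.snd_add, Prod.smul_fst, Prod.smul_snd,
      smul_eq_mul] at *
    have e : u * (s * a.1 + t * b.1) + v * (s * a.2 + t * b.2)
        = s * (u * a.1 + v * a.2) + t * (u * b.1 + v * b.2) := by ring
    rw [e]
    generalize u * a.1 + v * a.2 = A at *
    generalize u * b.1 + v * b.2 = B at *
    generalize u * p.1 + v * p.2 = K at *
    rcases hs.lt_or_eq with h0 | h0
    · have ht' : t = 1 - s := by linarith
      have f1 := mul_pos h0 (sub_pos.2 ha)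
      have f2 := mul_nonneg ht (sub_pos.2 hb).le
      have f3 : s * A + t * B = K + s * (A - K) + t * (B - K) := by rw [ht']; ring
      linarith
    · have : t = 1 := by linarith
      subst this; rw [← h0]; linarith
  have := convexHull_min (s := ((T.erase p : Finset (ℝ × ℝ)) : Set (ℝ × ℝ))) (fun q hq => by
    rw [Finset.mem_coe, Finset.mem_erase] at hq
    exact h q hq.2 hq.1) hconv hp
  exact lt_irrefl (u * p.1 + v * p.2) this

/-- supporting line below a point of a cup -/
lemma CupSet.support {f : ℝ → ℝ} {C : Finset ℝ} (hC : CupSet (gcup f) C) {x : ℝ} (hx : x ∈ C) :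
    ∃ σ, ∀ y ∈ C, y ≠ x → σ * (y - x) < f y - f x := by
  obtain ⟨σ, h1, h2⟩ := Finset.exists_between'
    ((C.filter (· < x)).image (fun y => (f x - f y) / (x - y)))
    ((C.filter (x < ·)).image (fun y => (f y - f x) / (y - x))) (by
      intro a ha b hb
      simp only [Finset.mem_image, Finset.mem_filter] at ha hb
      obtain ⟨y, ⟨hy, hyx⟩, rfl⟩ := ha
      obtain ⟨z, ⟨hz, hxz⟩, rfl⟩ := hb
      have := hC y hy x hx z hz hyx hxz
      unfold gcup at this
      rw [div_lt_div_iff₀ (sub_pos.2 hyx) (sub_pos.2 hxz)]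
      linarith)
  refine ⟨σ, fun y hy hne => ?_⟩
  rcases lt_or_gt_of_ne hne with h | h
  · have := h1 _ (Finset.mem_image_of_mem _ (Finset.mem_filter.2 ⟨hy, h⟩))
    rw [div_lt_iff₀ (sub_pos.2 h)] at this
    linarith
  · have := h2 _ (Finset.mem_image_of_mem _ (Finset.mem_filter.2 ⟨hy, h⟩))
    rw [lt_div_iff₀ (sub_pos.2 h)] at this
    linarith

def ConvPos (T : Finset (ℝ × ℝ)) : Prop :=
  ∀ p ∈ T, p ∉ convexHull ℝ ((T.erase p : Finset (ℝ × ℝ)) : Set (ℝ × ℝ))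

def gr (f : ℝ → ℝ) (x : ℝ) : ℝ × ℝ := (x, f x)

lemma gr_inj (f : ℝ → ℝ) : Function.Injective (gr f) := fun _ _ h => congrArg Prod.fst h

lemma ConvPos.subset {T T' : Finset (ℝ × ℝ)} (h : T' ⊆ T) (hT : ConvPos T) : ConvPos T' := by
  intro p hp hp'
  exact hT p (h hp) (convexHull_mono (by exact_mod_cast Finset.erase_subset_erase p h) hp')

lemma CupSet.convPos {f : ℝ → ℝ} {C : Finset ℝ} (hC : CupSet (gcup f) C) :
    ConvPos (C.image (gr f)) := by
  intro p hp
  obtain ⟨x, hx, rfl⟩ := Finset.mem_image.1 hp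
  obtain ⟨σ, hσ⟩ := hC.support hx
  apply notMem_hull _ _ (-σ) 1
  intro q hq hne
  obtain ⟨y, hy, rfl⟩ := Finset.mem_image.1 hq
  have := hσ y hy (fun h => hne (by rw [h]))
  simp only [gr]
  linarith

lemma top_convPos {f : ℝ → ℝ} {X C : Finset ℝ} {r s t : ℝ} (hC : IsCup (gcup f) X C r s)
    (hrt : r < t) (hts : t < s)
    (hcap : (t - r) * (f s - f t) - (s - t) * (f t - f r) < 0) :
    ConvPos ((insert t C).image (gr f)) := by
  obtain ⟨-, hcup, hr, hs, hrs⟩ := hC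
  have ptr : 0 < t - r := sub_pos.2 hrt
  have pst : 0 < s - t := sub_pos.2 hts
  intro p hp
  obtain ⟨x, hx, rfl⟩ := Finset.mem_image.1 hp
  have red : ∀ u v : ℝ, (∀ y ∈ insert t C, y ≠ x → u * x + v * f x < u * y + v * f y) →
      gr f x ∉ convexHull ℝ
        ((((insert t C).image (gr f)).erase (gr f x) : Finset (ℝ × ℝ)) : Set (ℝ × ℝ)) := by
    intro u v h
    apply notMem_hull _ _ u v
    intro q hq hne
    obtain ⟨y, hy, rfl⟩ := Finset.mem_image.1 hq
    exact h y hy (fun h => hne (by rw [h]))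
  by_cases hxt : x = t
  · subst hxt
    -- functional: below the chord
    apply red (f s - f r) (-(s - r))
    intro y hy hne
    have hyC : y ∈ C := (Finset.mem_insert.1 hy).resolve_left hne
    have hle : (s - r) * (f y - f r) ≤ (f s - f r) * (y - r) := by
      rcases (hrs y hyC).1.lt_or_eq with h | h
      · rcases (hrs y hyC).2.lt_or_eq with h' | h'
        · have := hcup r hr y hyC s hs h h'
          unfold gcup at this
          nlinarith [this]
        · rw [h']; linarith
      · rw [← h]; linarith
    nlinarith [hcap, hle]
  have hxC : x ∈ C := (Finset.mem_insert.1 hx).resolve_left hxt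
  by_cases hxr : x = r
  · subst hxr
    apply red 1 0
    intro y hy hne
    rcases Finset.mem_insert.1 hy with h | h
    · rw [h]; linarith
    · have := lt_of_le_of_ne (hrs y h).1 hne.symm
      linarith
  by_cases hxs : x = s
  · subst hxs
    apply red (-1) 0
    intro y hy hne
    rcases Finset.mem_insert.1 hy with h | h
    · rw [h]; linarith
    · have := lt_of_le_of_ne (hrs y h).2 hne
      linarith
  obtain ⟨σ, hσ⟩ := hcup.support hxC
  apply red (-σ) 1
  intro y hy hne
  rcases Finset.mem_insert.1 hy with h | h
  · rw [h]
    have e1 := hσ r hr (Ne.symm hxr)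
    have e2 := hσ s hs (Ne.symm hxs)
    have e3 := mul_pos pst (sub_pos.2 e1)
    have e4 := mul_pos ptr (sub_pos.2 e2)
    have e5 : 0 < (s - r) * ((f t - f x) - σ * (t - x)) := by nlinarith [e3, e4, hcap]
    have := (pos_iff_pos_of_mul_pos e5).1 (by linarith)
    linarith
  · have := hσ y h hne
    linarith

lemma collinear_of_det (x y z a b c : ℝ) (hxy : x < y)
    (h : (y - x) * (c - b) - (z - y) * (b - a) = 0) :
    Collinear ℝ ({(x, a), (y, b), (z, c)} : Set (ℝ × ℝ)) := by
  rw [collinear_iff_of_mem (p₀ := ((x, a) : ℝ × ℝ)) (by simp)]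
  have hne : y - x ≠ 0 := (sub_pos.2 hxy).ne'
  refine ⟨(y - x, b - a), ?_⟩
  intro p hp
  simp only [Set.mem_insert_iff, Set.mem_singleton_iff] at hp
  rcases hp with rfl | rfl | rfl
  · exact ⟨0, by simp⟩
  · exact ⟨1, by simp⟩
  · refine ⟨(z - x) / (y - x), ?_⟩
    ext
    · simp; field_simp; ring
    · simp; field_simp; linarith

end geometry

theorem stmt0 (n : ℕ) (hn : 3 ≤ n) (P : Finset (ℝ × ℝ))
    (hcard : P.card = Nat.choose (n - 1) 2 + 2)
    (hx : ∀ p ∈ P, ∀ q ∈ P, p ≠ q → p.1 ≠ q.1)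
    (hline : ∀ p ∈ P, ∀ q ∈ P, ∀ r ∈ P, p ≠ q → q ≠ r → p ≠ r →
      ¬ Collinear ℝ ({p, q, r} : Set (ℝ × ℝ))) :
    (∃ p₁ ∈ P, ∃ p₂ ∈ P, ∃ p₃ ∈ P, ∃ p₄ ∈ P,
      p₁.1 < p₂.1 ∧ p₂.1 < p₃.1 ∧ p₃.1 < p₄.1 ∧
      GeomCap3 p₁ p₂ p₃ ∧ GeomCap3 p₂ p₃ p₄) ∨
    (∃ T ⊆ P, T.card = n ∧
      ∀ p ∈ T, (p : ℝ × ℝ) ∉ convexHull ℝ ((T.erase p : Finset (ℝ × ℝ)) : Set (ℝ × ℝ))) := by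
  obtain ⟨m, rfl⟩ : ∃ m, n = m + 1 := ⟨n - 1, by omega⟩
  simp only [Nat.add_sub_cancel] at hcard
  set X := P.image Prod.fst with hX
  have hinj : Set.InjOn Prod.fst (P : Set (ℝ × ℝ)) := by
    intro p hp q hq h
    by_contra hne
    exact hx p hp q hq hne h
  have hXc : X.card = m.choose 2 + 2 := by
    rw [hX, Finset.card_image_of_injOn hinj, hcard]
  have hf : ∀ x : ℝ, ∃ y : ℝ, x ∈ X → (x, y) ∈ P := by
    intro x
    by_cases h : x ∈ X
    · obtain ⟨p, hp, rfl⟩ := Finset.mem_image.1 h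
      exact ⟨p.2, fun _ => hp⟩
    · exact ⟨0, fun h' => absurd h' h⟩
  choose f hf using hf
  have hne0 : ∀ x ∈ X, ∀ y ∈ X, ∀ z ∈ X, x < y → y < z → ¬ gcup f x y z →
      (y - x) * (f z - f y) - (z - y) * (f y - f x) < 0 := by
    intro x hx y hy z hz hxy hyz h
    unfold gcup at h
    refine lt_of_le_of_ne (not_lt.1 h) (fun h0 => ?_)
    refine hline _ (hf x hx) _ (hf y hy) _ (hf z hz) ?_ ?_ ?_ (collinear_of_det x y z _ _ _ hxy h0)
    · exact fun h => hxy.ne (congrArg Prod.fst h)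
    · exact fun h => hyz.ne (congrArg Prod.fst h)
    · exact fun h => (hxy.trans hyz).ne (congrArg Prod.fst h)
  by_cases h4 : NoCap4 (gcup f) X
  swap
  · left
    unfold NoCap4 at h4
    push Not at h4
    obtain ⟨i, hi, j, hj, k, hk, l, hl, hij, hjk, hkl, h1, h2⟩ := h4
    exact ⟨_, hf i hi, _, hf j hj, _, hf k hk, _, hf l hl, hij, hjk, hkl,
      hne0 i hi j hj k hk hij hjk h1, hne0 j hj k hk l hl hjk hkl h2⟩
  right
  have fin : ∀ C ⊆ X, m + 1 ≤ C.card → ConvPos (C.image (gr f)) →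
      ∃ T ⊆ P, T.card = m + 1 ∧ ConvPos T := by
    intro C hC hCc hconv
    obtain ⟨D, hD, hDc⟩ := Finset.exists_subset_card_eq hCc
    refine ⟨D.image (gr f), ?_, ?_, hconv.subset (Finset.image_subset_image hD)⟩
    · intro p hp
      obtain ⟨x, hx, rfl⟩ := Finset.mem_image.1 hp
      exact hf x (hC (hD hx))
    · rw [Finset.card_image_of_injective _ (gr_inj f), hDc]
  rcases has_gon (gcup_trans f) h4 hXc.ge with ⟨C, hC, hcup, hCc⟩ | ⟨C, r, s, t, hC, hCc, htX, hrt, hts, hcap⟩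
  · exact fin C hC hCc hcup.convPos
  · have htC : t ∉ C := fun h => hcap (hC.2.1 r hC.2.2.1 t h s hC.2.2.2.1 hrt hts)
    apply fin (insert t C)
    · exact Finset.insert_subset htX hC.1
    · rw [Finset.card_insert_of_notMem htC, hCc]
    · exact top_convPos hC hrt hts (hne0 r (hC.1 hC.2.2.1) t htX s (hC.1 hC.2.2.2.1) hrt hts hcap)
end

section
/- For any n ≥ 3, any configuration of size C(n-1,2)+2 contains a 4-cap, an n-cup, or a weak (3, n-1)-gon (a 3-cap and an (n-1)-cup with the same two endpoints). -/
variable {α : Type*} [LinearOrder α]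

/-- Every consecutive triple of the list satisfies `f`. -/
def Triples (f : α → α → α → Prop) : List α → Prop
  | x :: y :: z :: l => f x y z ∧ Triples f (y :: z :: l)
  | _ => True

/-- `l` is a cup in the configuration `(S, cup)`: a nonempty increasing list of
vertices of `S` all of whose consecutive triples are colored cup. -/
def IsCupIn (S : Finset α) (cup : α → α → α → Prop) (l : List α) : Prop :=
  l ≠ [] ∧ l.Chain' (· < ·) ∧ (∀ x ∈ l, x ∈ S) ∧ Triples cup l

/-- `l` is a cap in the configuration `(S, cup)`. -/
def IsCapIn (S : Finset α) (cup : α → α → α → Prop) (l : List α) : Prop :=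
  l ≠ [] ∧ l.Chain' (· < ·) ∧ (∀ x ∈ l, x ∈ S) ∧ Triples (fun x y z => ¬ cup x y z) l

/-- The configuration has no cap with `a` (or more) vertices. -/
def CapFree (S : Finset α) (cup : α → α → α → Prop) (a : ℕ) : Prop :=
  ∀ l : List α, IsCapIn S cup l → l.length < a

/-- The configuration has no cup with `b` (or more) vertices. -/
def CupFree (S : Finset α) (cup : α → α → α → Prop) (b : ℕ) : Prop :=
  ∀ l : List α, IsCupIn S cup l → l.length < b

def StartsAt (l : List α) (p : α) : Prop := l.head? = some p

def EndsAt (l : List α) (p : α) : Prop := l.getLast? = some p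

/-- A weak `(a, b)`-gon: an `a`-cap and a `b`-cup sharing both endpoints. -/
def HasWeakGon (S : Finset α) (cup : α → α → α → Prop) (a b : ℕ) : Prop :=
  ∃ (A U : List α) (x y : α), IsCapIn S cup A ∧ A.length = a ∧
    IsCupIn S cup U ∧ U.length = b ∧
    StartsAt A x ∧ StartsAt U x ∧ EndsAt A y ∧ EndsAt U y

/-- Two cups from `p` to `r` and from `q` to `s` are interweaved if `p < q ≤ r < s`. -/
def Interweaved (C₁ C₂ : List α) : Prop :=
  ∃ p r q s, StartsAt C₁ p ∧ EndsAt C₁ r ∧ StartsAt C₂ q ∧ EndsAt C₂ s ∧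
    p < q ∧ q ≤ r ∧ r < s

/-- A laced `(n-1)`-cup: an `(n-1)`-cup from `p` to `q` together with a cup ending
at `p` and a cup starting at `q` whose sizes sum to `n - 1`. -/
def IsLacedCup (S : Finset α) (cup : α → α → α → Prop) (n : ℕ) (C : List α) : Prop :=
  IsCupIn S cup C ∧ C.length = n - 1 ∧
  ∃ p q Cp Cq, StartsAt C p ∧ EndsAt C q ∧ IsCupIn S cup Cp ∧ IsCupIn S cup Cq ∧
    EndsAt Cp p ∧ StartsAt Cq q ∧ Cp.length + Cq.length = n - 1

/-- A slope labeling of an `a`-cap-free configuration: labels in `{1, …, a-2}`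
such that `s x y ≤ s y z` forces `x y z` to be a cup. -/
def IsSlopeLabeling (S : Finset α) (cup : α → α → α → Prop) (a : ℕ) (s : α → α → ℕ) : Prop :=
  (∀ x ∈ S, ∀ y ∈ S, x < y → 1 ≤ s x y ∧ s x y ≤ a - 2) ∧
  (∀ x ∈ S, ∀ y ∈ S, ∀ z ∈ S, x < y → y < z → s x y ≤ s y z → cup x y z)

/-- `α_i(p)`: maximum length of a cup ending at `p` with last edge of label `≤ i`
(`1` if there is no such cup). -/
noncomputable def alphaStat (S : Finset α) (cup : α → α → α → Prop) (s : α → α → ℕ)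
    (i : ℕ) (p : α) : ℕ :=
  max 1 (sSup {k | ∃ (l : List α) (x : α), IsCupIn S cup l ∧ EndsAt l p ∧
    l.length = k ∧ l.dropLast.getLast? = some x ∧ s x p ≤ i})

/-- `β(p)`: maximum length of a cup ending at `p` (`1` if there is none). -/
noncomputable def betaStat (S : Finset α) (cup : α → α → α → Prop) (p : α) : ℕ :=
  max 1 (sSup {k | ∃ l : List α, IsCupIn S cup l ∧ EndsAt l p ∧ l.length = k})

/-- The cup coloring of the mirror reflection. -/
def opCup (cup : α → α → α → Prop) : αᵒᵈ → αᵒᵈ → αᵒᵈ → Prop :=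
  fun x y z => cup (OrderDual.ofDual z) (OrderDual.ofDual y) (OrderDual.ofDual x)

/-- The vertex set of the mirror reflection. -/
def opSet (S : Finset α) : Finset αᵒᵈ := S.map OrderDual.toDual.toEmbedding

/-- The mirror reflection of a cap/cup. -/
def opList (l : List α) : List αᵒᵈ := (l.map OrderDual.toDual).reverse

/-! ## The two-coloured model -/

/-- `Pth S c k u v`: an increasing path in `S` with `k` vertices from `u` to `v`, whose
edges satisfy first `c` and then `¬ c`. -/
inductive Pth {α : Type*} [LinearOrder α] (S : Finset α) (c : α → α → Prop) :
    ℕ → α → α → Prop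
  | single (v : α) : v ∈ S → Pth S c 1 v v
  | pre (k : ℕ) (u v w : α) : u ∈ S → u < v → c u v → Pth S c k v w → Pth S c (k + 1) u w
  | app (k : ℕ) (u v w : α) : w ∈ S → v < w → ¬ c v w → Pth S c k u v → Pth S c (k + 1) u w

namespace Pth

theorem pos {S : Finset α} {c : α → α → Prop} {k : ℕ} {u v : α} (h : Pth S c k u v) :
    1 ≤ k := by
  cases h <;> omega

theorem mems {S : Finset α} {c : α → α → Prop} {k : ℕ} {u v : α} (h : Pth S c k u v) :
    u ∈ S ∧ v ∈ S ∧ u ≤ v := by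
  induction h with
  | single v hv => exact ⟨hv, hv, le_rfl⟩
  | pre k u v w hu huv _ _ ih => exact ⟨hu, ih.2.1, huv.le.trans ih.2.2⟩
  | app k u v w hw hvw _ _ ih => exact ⟨ih.1, hw, ih.2.2.trans hvw.le⟩

theorem mono {S T : Finset α} (hST : T ⊆ S) {c : α → α → Prop} {k : ℕ} {u v : α}
    (h : Pth T c k u v) : Pth S c k u v := by
  induction h with
  | single v hv => exact single v (hST hv)
  | pre k u v w hu huv hc _ ih => exact pre k u v w (hST hu) huv hc ih
  | app k u v w hw hvw hc _ ih => exact app k u v w (hST hw) hvw hc ih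

theorem mirror {S : Finset α} {c : α → α → Prop} {k : ℕ} {u v : α} (h : Pth S c k u v) :
    Pth (α := αᵒᵈ) S (fun x y => ¬ c y x) k v u := by
  induction h with
  | single v hv => exact single (α := αᵒᵈ) v hv
  | pre k u v w hu huv hc _ ih =>
    exact app (α := αᵒᵈ) k w v u hu huv (fun h => h hc) ih
  | app k u v w hw hvw hc _ ih => exact pre (α := αᵒᵈ) k w v u hw hvw hc ih

theorem of_mirror {S : Finset α} {c : α → α → Prop} {k : ℕ} {u v : α}
    (h : Pth (α := αᵒᵈ) S (fun x y => ¬ c y x) k v u) : Pth S c k u v := by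
  induction h with
  | single v hv => exact single (α := α) v hv
  | pre k u v w hu huv hc _ ih => exact app (α := α) k w v u hu huv hc ih
  | app k u v w hw hvw hc _ ih => exact pre (α := α) k w v u hw hvw (not_not.1 hc) ih

theorem one {S : Finset α} {c : α → α → Prop} {u v : α} (h : Pth S c 1 u v) : u = v := by
  cases h with
  | single => rfl
  | pre k _ v _ _ _ _ h => exact absurd h.pos (by omega)
  | app k _ v _ _ _ _ h => exact absurd h.pos (by omega)

theorem dropLast {S : Finset α} {c : α → α → Prop} {k : ℕ} {u w : α}
    (h : Pth S c k u w) (hk : 2 ≤ k) : ∃ v, Pth S c (k - 1) u v ∧ v < w := by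
  induction h with
  | single v hv => omega
  | pre k u v w hu huv hc h ih =>
    by_cases hk1 : k = 1
    · subst hk1
      obtain rfl := h.one
      exact ⟨u, single u hu, huv⟩
    · obtain ⟨x, hx, hxw⟩ := ih (by have := h.pos; omega)
      refine ⟨x, ?_, hxw⟩
      have := pre _ u v x hu huv hc hx
      have hp := h.pos
      rwa [show k - 1 + 1 = k + 1 - 1 by omega] at this
  | app k u v w hw hvw hc h ih => exact ⟨v, h, hvw⟩

theorem dropFirst {S : Finset α} {c : α → α → Prop} {k : ℕ} {u w : α}
    (h : Pth S c k u w) (hk : 2 ≤ k) : ∃ v, Pth S c (k - 1) v w ∧ u < v := by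
  obtain ⟨v, hv, hvw⟩ := dropLast h.mirror hk
  exact ⟨v, hv.of_mirror, hvw⟩

theorem shorten {S : Finset α} {c : α → α → Prop} {k : ℕ} {u w : α}
    (h : Pth S c k u w) (j : ℕ) (hj : 1 ≤ j) (hjk : j ≤ k) : ∃ v, Pth S c j u v := by
  induction k generalizing w with
  | zero => omega
  | succ k ih =>
    by_cases hk : j = k + 1
    · subst hk; exact ⟨w, h⟩
    · obtain ⟨v, hv, _⟩ := h.dropLast (by omega)
      exact ih hv (by omega)

end Pth

/-- Two interweaved laced paths with `N` vertices. -/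
def GoodPair {α : Type*} [LinearOrder α] (S : Finset α) (c : α → α → Prop) (N : ℕ) : Prop :=
  ∃ p q r s x y z w i j i' j', p < q ∧ q ≤ r ∧ r < s ∧ Pth S c N p r ∧ Pth S c N q s ∧
    Pth S c i x p ∧ Pth S c j r y ∧ N ≤ i + j ∧
    Pth S c i' z q ∧ Pth S c j' s w ∧ N ≤ i' + j'

theorem GoodPair.of_mirror {S : Finset α} {c : α → α → Prop} {N : ℕ}
    (h : GoodPair (α := αᵒᵈ) S (fun x y => ¬ c y x) N) : GoodPair S c N := by
  obtain ⟨p, q, r, s, x, y, z, w, i, j, i', j', h1, h2, h3, h4, h5, h6, h7, h8, h9, h10, h11⟩ := h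
  exact ⟨s, r, q, p, w, z, y, x, j', i', j, i, h3, h2, h1, h5.of_mirror, h4.of_mirror,
    h10.of_mirror, h9.of_mirror, by omega, h7.of_mirror, h6.of_mirror, by omega⟩

/-- longest path ending at `v`. -/
noncomputable def lft {α : Type*} [LinearOrder α] (S : Finset α) (c : α → α → Prop) (N : ℕ)
    (v : α) : ℕ :=
  open Classical in Nat.findGreatest (fun k => ∃ u, Pth S c k u v) N

section half

variable {S : Finset α} {c : α → α → Prop} {N : ℕ}

theorem le_of_free (hfree : ∀ u v, ¬ Pth S c (N + 1) u v) {k : ℕ} {u v : α}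
    (h : Pth S c k u v) : k ≤ N := by
  by_contra hk
  obtain ⟨x, hx⟩ := h.shorten (N + 1) (by omega) (by omega)
  exact hfree _ _ hx

theorem le_lft (hfree : ∀ u v, ¬ Pth S c (N + 1) u v) {k : ℕ} {u v : α}
    (h : Pth S c k u v) : k ≤ lft S c N v := by
  classical
  exact Nat.le_findGreatest (le_of_free hfree h) ⟨u, h⟩

theorem lft_spec (hN : 1 ≤ N) {v : α} (hv : v ∈ S) : ∃ u, Pth S c (lft S c N v) u v := by
  classical
  exact Nat.findGreatest_spec (P := fun k => ∃ u, Pth S c k u v) hN ⟨v, Pth.single v hv⟩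

theorem lft_pos (hN : 1 ≤ N) {v : α} (hv : v ∈ S) : 1 ≤ lft S c N v := by
  obtain ⟨u, hu⟩ := lft_spec (c := c) hN hv
  exact hu.pos

theorem lft_le (v : α) : lft S c N v ≤ N := by
  classical
  exact Nat.findGreatest_le _

/-- the first vertex at level `k` -/
theorem exists_first (hfree : ∀ u v, ¬ Pth S c (N + 1) u v) (hN : 1 ≤ N) {v : α} (hv : v ∈ S) :
    ∃ w ∈ S, lft S c N w = lft S c N v ∧ ∀ x ∈ S, lft S c N v ≤ lft S c N x → w ≤ x := by
  classical
  have hne : (S.filter (fun x => lft S c N v ≤ lft S c N x)).Nonempty := ⟨v, by simp [hv]⟩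
  obtain ⟨w, hw, hmin⟩ := Finset.exists_min_image _ id hne
  simp only [Finset.mem_filter, id] at hw hmin
  refine ⟨w, hw.1, ?_, fun x hx hx' => hmin x ⟨hx, hx'⟩⟩
  by_contra hne
  have hlt : lft S c N v < lft S c N w := lt_of_le_of_ne hw.2 (Ne.symm hne)
  obtain ⟨u, hu⟩ := lft_spec (c := c) hN hw.1
  have hp := lft_pos (c := c) hN hv
  obtain ⟨x, hx, hxw⟩ := hu.dropLast (by omega)
  have := le_lft hfree hx
  exact absurd (hmin x ⟨hx.mems.2.1, by omega⟩) (not_le.2 hxw)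

/-- `N = m + 3` below. -/
theorem half (m : ℕ)
    (ih : ∀ T : Finset α, (∀ u v, ¬ Pth T c (m + 3) u v) → Nat.choose (m + 2) 2 + 2 ≤ T.card →
      GoodPair T c (m + 2))
    (hfree : ∀ u v, ¬ Pth S c (m + 4) u v) (hcard : Nat.choose (m + 3) 2 + 2 ≤ S.card) :
    GoodPair S c (m + 3) ∨ ∃ b z y, Pth S c (m + 3) z b ∧
      (∀ b' z', Pth S c (m + 3) z' b' → b ≤ b') ∧ Pth S c (m + 2) b y := by
  classical
  have hN : 1 ≤ m + 3 := by omega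
  set l := lft S c (m + 3) with hl
  by_cases hAB : ∃ z v y, Pth S c (m + 3) z v ∧ Pth S c (m + 3) v y
  · obtain ⟨z, v, y, h1, h2⟩ := hAB
    left
    obtain ⟨z', h1', hz⟩ := h1.dropFirst (by omega)
    obtain ⟨y', h2', hy⟩ := h2.dropFirst (by omega)
    exact ⟨z, v, v, y, z, y, z, y, 1, m + 3, m + 3, 1, lt_of_lt_of_le hz h1'.mems.2.2, le_rfl,
      lt_of_lt_of_le hy h2'.mems.2.2, h1, h2, Pth.single z h1.mems.1, h2, by omega, h1,
      Pth.single y h2.mems.2.1, by omega⟩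
  -- the removed set
  set D := S.filter (fun v => l v ≤ m + 2 ∧ ∀ w ∈ S, w < v → l w ≠ l v) with hD
  set T := S \ D with hT
  have hTS : T ⊆ S := Finset.sdiff_subset
  have hDcard : D.card ≤ m + 2 := by
    have : D.card ≤ (Finset.Icc 1 (m + 2)).card := by
      apply Finset.card_le_card_of_injOn l
      · intro v hv
        have hv := (Finset.mem_filter.1 hv)
        simp only [Finset.coe_Icc, Set.mem_Icc]
        exact ⟨lft_pos hN hv.1, hv.2.1⟩
      · intro v hv w hw hvw
        have hv := (Finset.mem_filter.1 hv)
        have hw := (Finset.mem_filter.1 hw)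
        rcases lt_trichotomy v w with h | h | h
        · exact absurd hvw (hw.2.2 v hv.1 h)
        · exact h
        · exact absurd hvw.symm (hv.2.2 w hw.1 h)
    simpa using this
  have hTcard : Nat.choose (m + 2) 2 + 2 ≤ T.card := by
    have h1 : T.card = S.card - D.card := Finset.card_sdiff_of_subset (Finset.filter_subset _ _)
    have h2 : Nat.choose (m + 3) 2 = Nat.choose (m + 2) 1 + Nat.choose (m + 2) 2 :=
      Nat.choose_succ_succ _ _
    rw [Nat.choose_one_right] at h2
    omega
  have twin : ∀ v ∈ T, (∃ w ∈ S, w < v ∧ l w = l v ∧ c w v) ∨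
      (l v = m + 3 ∧ ∀ w ∈ S, l w = m + 3 → v ≤ w) := by
    intro v hv
    have hvS := hTS hv
    have hvD : v ∉ D := (Finset.mem_sdiff.1 hv).2
    by_cases hex : ∃ w ∈ S, w < v ∧ l w = l v
    · obtain ⟨w, hw, hwv, hlw⟩ := hex
      left
      refine ⟨w, hw, hwv, hlw, ?_⟩
      by_contra hc
      obtain ⟨u, hu⟩ := lft_spec (c := c) hN hw
      have := le_lft hfree (Pth.app _ u w v hvS hwv hc hu)
      rw [← hl] at this
      omega
    · right
      push Not at hex
      have hlv : l v = m + 3 := by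
        have h1 := lft_le (S := S) (c := c) (N := m + 3) v
        rw [← hl] at h1
        by_contra hne
        exact hvD (Finset.mem_filter.2 ⟨hvS, by omega, hex⟩)
      refine ⟨hlv, fun w hw hlw => ?_⟩
      by_contra hlt
      exact hex w hw (not_le.1 hlt) (hlw.trans hlv.symm)
  have hTfree : ∀ u v, ¬ Pth T c (m + 3) u v := by
    intro u v h
    rcases twin u h.mems.1 with ⟨w, hw, hwu, _, hc⟩ | ⟨hlu, _⟩
    · exact hfree _ _ (Pth.pre _ w u v hw hwu hc (h.mono hTS))
    · obtain ⟨z, hz⟩ := lft_spec (c := c) hN (hTS h.mems.1)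
      rw [← hl, hlu] at hz
      exact hAB ⟨z, u, v, hz, h.mono hTS⟩
  obtain ⟨p, q, r, s, x, y, z, w, i, j, i', j', h1, h2, h3, h4, h5, h6, h7, h8, h9, h10, h11⟩ :=
    ih T hTfree hTcard
  -- every edge of T into a start of an (m+2)-path is not c
  have hin : ∀ u ∈ T, ∀ v t, Pth T c (m + 2) v t → u < v → ¬ c u v := fun u hu v t h huv hc =>
    hTfree _ _ (Pth.pre _ u v t hu huv hc h)
  have key : ∀ v t i x, Pth T c (m + 2) v t → Pth T c i x v →
      (l v = m + 3 ∧ ∀ w ∈ S, l w = m + 3 → v ≤ w) ∨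
      (i + 1 ≤ l v ∧ ∃ v' ∈ S, l v' = l v ∧ v' < v ∧ c v' v ∧
        ∀ x ∈ S, l v ≤ l x → v' ≤ x) := by
    intro v t i x hv hx
    by_cases hspec : l v = m + 3 ∧ ∀ w ∈ S, l w = m + 3 → v ≤ w
    · exact Or.inl hspec
    right
    have hvT := hv.mems.1
    have hvS := hTS hvT
    have hxT := hx.mems.1
    constructor
    · rcases twin x hxT with ⟨w, hw, hwx, _, hc⟩ | ⟨hlx, hmin⟩
      · exact le_lft hfree (Pth.pre _ w x v hw hwx hc (hx.mono hTS))
      · exfalso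
        rcases hx.mems.2.2.eq_or_lt with rfl | hlt
        · exact hspec ⟨hlx, hmin⟩
        · obtain ⟨u, hu⟩ := lft_spec (c := c) hN (hTS hxT)
          rw [← hl, hlx] at hu
          exact hfree _ _ (Pth.app _ u x v hvS hlt (hin x hxT v t hv hlt) hu)
    · obtain ⟨v', hv', hlv', hmin⟩ := exists_first hfree hN hvS
      rcases twin v hvT with ⟨w, hw, hwv, hlw, _⟩ | h
      · have hlt : v' < v := lt_of_le_of_lt (hmin w hw hlw.ge) hwv
        refine ⟨v', hv', hlv', hlt, ?_, hmin⟩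
        by_contra hc
        obtain ⟨u, hu⟩ := lft_spec (c := c) hN hv'
        have := le_lft hfree (Pth.app _ u v' v hvS hlt hc hu)
        omega
      · exact absurd h hspec
  have hlpq : l p + 1 ≤ l q := by
    obtain ⟨u, hu⟩ := lft_spec (c := c) hN (hTS h4.mems.1)
    exact le_lft hfree (Pth.app _ u p q (hTS h5.mems.1) h1 (hin p h4.mems.1 q s h5 h1) hu)
  have hlq := lft_le (S := S) (c := c) (N := m + 3) q
  rcases key q s i' z h5 h9 with ⟨hlq', hmin⟩ | ⟨hi', q', hq', hlq', hq'q, hcq, hminq⟩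
  · right
    obtain ⟨u, hu⟩ := lft_spec (c := c) hN (hTS h5.mems.1)
    rw [← hl, hlq'] at hu
    refine ⟨q, u, s, hu, fun b' z' hb => hmin b' hb.mems.2.1 ?_, h5.mono hTS⟩
    have e1 := le_lft hfree hb
    have e2 := lft_le (S := S) (c := c) (N := m + 3) b'
    exact le_antisymm e2 e1
  · left
    rcases key p r i x h4 h6 with ⟨hlp', hmin⟩ | ⟨hi, p', hp', hlp', hp'p, hcp, hminp⟩
    · rw [← hl] at hlq; omega
    · have hpq' : p' < q' := by
        refine lt_of_le_of_ne (hminp q' hq' (by omega)) ?_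
        rintro rfl
        omega
      obtain ⟨u, hu⟩ := lft_spec (c := c) hN hp'
      obtain ⟨u', hu'⟩ := lft_spec (c := c) hN hq'
      rw [← hl] at hu hu'
      exact ⟨p', q', r, s, u, y, u', w, l p', j, l q', j', hpq', hq'q.le.trans h2, h3,
        Pth.pre _ p' p r hp' hp'p hcp (h4.mono hTS), Pth.pre _ q' q s hq' hq'q hcq (h5.mono hTS),
        hu, h7.mono hTS, by omega, hu', h10.mono hTS, by omega⟩

/-- One half of the final argument in the bad case. -/
theorem bad_half {S : Finset α} {c : α → α → Prop} (m : ℕ) {a b z e f : α}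
    (hz : Pth S c (m + 3) z b) (ha : ∀ a' y', Pth S c (m + 3) a' y' → a' ≤ a)
    (he : Pth S c (m + 2) e a) (hf : Pth S c (m + 2) b f) :
    ∃ q, q < a ∧ Pth S c (m + 3) q b := by
  rcases (ha z b hz).eq_or_lt with rfl | hlt
  · obtain ⟨v, hv, hzv⟩ := hz.dropFirst (by omega)
    obtain ⟨u, hu, huz⟩ := he.dropLast (by omega)
    by_cases hc : c u v
    · exact ⟨u, huz, Pth.pre _ u v b hu.mems.2.1 (huz.trans hzv) hc hv⟩
    · have hvb : v < b := by
        obtain ⟨v', hv', h⟩ := hv.dropFirst (by omega)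
        exact lt_of_lt_of_le h hv'.mems.2.2
      by_cases hc' : c v b
      · exact absurd (ha v f (Pth.pre _ v b f hv.mems.1 hvb hc' hf)) (not_le.2 hzv)
      · exact ⟨e, lt_of_le_of_lt hu.mems.2.2 huz, Pth.app _ e v b hf.mems.1 hvb hc'
          (Pth.app _ e u v hv.mems.1 (huz.trans hzv) hc hu)⟩
  · exact ⟨z, hlt, hz⟩

end half

theorem main_model.{u} (m : ℕ) : ∀ (α : Type u) [LinearOrder α] (S : Finset α) (c : α → α → Prop),
    (∀ u v, ¬ Pth S c (m + 3) u v) → Nat.choose (m + 2) 2 + 2 ≤ S.card →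
      GoodPair S c (m + 2) := by
  induction m with
  | zero =>
    intro α _ S c hfree hcard
    have h3 : 3 ≤ S.card := by simpa using hcard
    obtain ⟨T, hTS, hT⟩ := Finset.exists_subset_card_eq h3
    let f := T.orderEmbOfFin hT
    have hf : ∀ i, f i ∈ S := fun i => hTS (Finset.orderEmbOfFin_mem T hT i)
    have h01 : f 0 < f 1 := f.strictMono (by decide)
    have h12 : f 1 < f 2 := f.strictMono (by decide)
    have edge : ∀ a b, a ∈ S → b ∈ S → a < b → Pth S c 2 a b := by
      intro a b ha hb hab
      by_cases hc : c a b
      · exact Pth.pre _ a b b ha hab hc (Pth.single b hb)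
      · exact Pth.app _ a a b hb hab hc (Pth.single a ha)
    have e01 := edge _ _ (hf 0) (hf 1) h01
    have e12 := edge _ _ (hf 1) (hf 2) h12
    exact ⟨f 0, f 1, f 1, f 2, f 0, f 2, f 0, f 2, 1, 2, 2, 1, h01, le_rfl, h12, e01, e12,
      Pth.single _ (hf 0), e12, by omega, e01, Pth.single _ (hf 2), by omega⟩
  | succ m ih =>
    intro α _ S c hfree hcard
    rcases half m (fun T => ih α T c) hfree hcard with h | ⟨b, z, f, hz, hb, hf⟩
    · exact h
    rcases half (α := αᵒᵈ) (S := S) (c := fun x y => ¬ c y x) m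
      (fun T => ih αᵒᵈ T _) (fun u v h => hfree _ _ h.of_mirror) hcard with
      h | ⟨a, y, e, hy, ha, he⟩
    · exact h.of_mirror
    have hy' := hy.of_mirror
    have he' := he.of_mirror
    have ha' : ∀ a' y', Pth S c (m + 3) a' y' → a' ≤ a := fun a' y' h => ha a' y' h.mirror
    obtain ⟨q, hqa, hq⟩ := bad_half m hz ha' he' hf
    obtain ⟨s, hsb, hs⟩ := bad_half (α := αᵒᵈ) (S := S) (c := fun x y => ¬ c y x) m hy
      (fun a' y' h => hb a' y' h.of_mirror) hf.mirror he
    have hs' : Pth S c (m + 3) a s := hs.of_mirror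
    have hab : @LE.le α _ a b := by
      by_contra hlt
      have hlt := not_le.1 hlt
      by_cases hc : c b a
      · exact hfree _ _ (Pth.pre _ b a s hf.mems.1 hlt hc hs')
      · exact hfree _ _ (Pth.app _ q b a hs'.mems.1 hlt hc hq)
    exact ⟨q, a, b, s, q, f, e, s, 1, m + 2, m + 2, 1, hqa, hab, hsb, hq, hs',
      Pth.single _ hq.mems.1, hf, by omega, he', Pth.single _ hs'.mems.2.1, by omega⟩

/-! ## Cup lists -/

section cuplists

variable {S : Finset α} {cup : α → α → α → Prop}

/-- possibly empty cups -/
def CupL {α : Type*} [LinearOrder α] (S : Finset α) (cup : α → α → α → Prop)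
    (l : List α) : Prop :=
  List.IsChain (· < ·) l ∧ (∀ x ∈ l, x ∈ S) ∧ Triples cup l

theorem triples_glue (f : α → α → α → Prop) (a b : α) (l' : List α) : ∀ l : List α,
    Triples f (l ++ [a, b]) → Triples f (a :: b :: l') → Triples f (l ++ a :: b :: l')
  | [], _, h => h
  | [_], h1, h2 => ⟨h1.1, h2⟩
  | [_, _], h1, h2 => ⟨h1.1, h1.2.1, h2⟩
  | x :: y :: z :: l, h1, h2 => ⟨h1.1, triples_glue f a b l' (y :: z :: l) h1.2 h2⟩

theorem triples_left (f : α → α → α → Prop) (l' : List α) : ∀ l : List α,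
    Triples f (l ++ l') → Triples f l
  | [], _ => trivial
  | [_], _ => trivial
  | [_, _], _ => trivial
  | _ :: y :: z :: l, h => ⟨h.1, triples_left f l' (y :: z :: l) h.2⟩

theorem CupL.glue {l l' : List α} {a b : α} (h1 : CupL S cup (l ++ [a, b]))
    (h2 : CupL S cup (a :: b :: l')) : CupL S cup (l ++ a :: b :: l') := by
  refine ⟨?_, ?_, triples_glue _ _ _ _ _ h1.2.2 h2.2.2⟩
  · have e1 := h1.1
    have e2 := h2.1
    rw [List.isChain_append] at e1 ⊢
    refine ⟨e1.1, e2, ?_⟩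
    simpa using e1.2.2
  · intro x hx
    rcases List.mem_append.1 hx with h | h
    · exact h1.2.1 x (List.mem_append_left _ h)
    · exact h2.2.1 x h

theorem CupL.take {l : List α} (h : CupL S cup l) (n : ℕ) : CupL S cup (l.take n) := by
  refine ⟨h.1.take n, fun x hx => h.2.1 x (List.mem_of_mem_take hx), ?_⟩
  apply triples_left cup (l.drop n)
  rw [List.take_append_drop]
  exact h.2.2

theorem CupL.cons {l : List α} {u v : α} (h : CupL S cup (v :: l)) (hu : u ∈ S) (huv : u < v)
    (hc : ∀ w ∈ S, v < w → l.head? = some w → cup u v w) : CupL S cup (u :: v :: l) := by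
  refine ⟨?_, ?_, ?_⟩
  · rw [List.isChain_cons_cons]; exact ⟨huv, h.1⟩
  · intro x hx
    rcases List.mem_cons.1 hx with rfl | hx
    · exact hu
    · exact h.2.1 x hx
  · cases l with
    | nil => trivial
    | cons w l =>
      refine ⟨hc w (h.2.1 w (by simp)) ?_ rfl, h.2.2⟩
      have := h.1
      rw [List.isChain_cons_cons] at this
      exact this.1

theorem CupL.snoc {l : List α} {v w : α} (h : CupL S cup (l ++ [v])) (hw : w ∈ S) (hvw : v < w)
    (hc : ∀ u ∈ S, u < v → l.getLast? = some u → cup u v w) : CupL S cup (l ++ [v, w]) := by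
  have hv : v ∈ S := h.2.1 v (by simp)
  rcases List.eq_nil_or_concat l with rfl | ⟨l, u, rfl⟩
  · refine ⟨by simp [hvw], by simp [hv, hw], trivial⟩
  · simp only [List.concat_eq_append, List.append_assoc, List.cons_append, List.nil_append] at h ⊢
    have huS : u ∈ S := h.2.1 u (by simp)
    have huv : u < v := by
      have := h.1
      rw [List.isChain_append] at this
      have h2 := this.2.1
      rw [List.isChain_cons_cons] at h2
      exact h2.1
    refine CupL.glue h ⟨by simp [huv, hvw], by simp [huS, hv, hw], ?_, trivial⟩
    exact hc u huS huv (by simp)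

end cuplists

section paths

variable {S : Finset α} {cup : α → α → α → Prop} {c : α → α → Prop}

theorem Pth.toList (h1 : ∀ u ∈ S, ∀ v ∈ S, ∀ w ∈ S, u < v → v < w → c u v → cup u v w)
    (h2 : ∀ u ∈ S, ∀ v ∈ S, ∀ w ∈ S, u < v → v < w → ¬ c v w → cup u v w)
    {k : ℕ} {u v : α} (h : Pth S c k u v) :
    ∃ l, CupL S cup l ∧ l.length = k ∧ l.head? = some u ∧ l.getLast? = some v := by
  induction h with
  | single v hv => exact ⟨[v], ⟨by simp, by simp [hv], trivial⟩, rfl, rfl, rfl⟩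
  | pre k u v w hu huv hc h ih =>
    obtain ⟨l, hl, hlen, hh, hlast⟩ := ih
    cases l with
    | nil => simp at hh
    | cons v' l =>
      simp only [List.head?_cons, Option.some.injEq] at hh
      subst hh
      refine ⟨u :: v' :: l, hl.cons hu huv (fun w hw hvw _ => h1 u hu v' h.mems.1 w hw huv hvw hc),
        by simpa using hlen, rfl, ?_⟩
      rw [List.getLast?_cons_cons]; exact hlast
  | app k u v w hw hvw hc h ih =>
    obtain ⟨l, hl, hlen, hh, hlast⟩ := ih
    rcases List.eq_nil_or_concat l with rfl | ⟨l, v', rfl⟩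
    · simp at hh
    · simp only [List.concat_eq_append, List.getLast?_append, List.getLast?_singleton,
        Option.some_or, Option.some.injEq] at hlast hl hlen hh
      subst hlast
      refine ⟨l ++ [v', w], hl.snoc hw hvw
        (fun u hu huv _ => h2 u hu v' h.mems.2.1 w hw huv hvw hc), ?_, ?_, by simp⟩
      · simp at hlen ⊢; omega
      · cases l <;> simpa using hh

theorem Pth.toListEnd (h1 : ∀ u ∈ S, ∀ v ∈ S, ∀ w ∈ S, u < v → v < w → c u v → cup u v w)
    (h2 : ∀ u ∈ S, ∀ v ∈ S, ∀ w ∈ S, u < v → v < w → ¬ c v w → cup u v w)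
    {k : ℕ} {p q : α} (h : Pth S c k p q) (hk : 2 ≤ k) :
    ∃ u l, Pth S c (k - 1) p u ∧ u < q ∧ CupL S cup (l ++ [u, q]) ∧ l.length + 2 = k ∧
      (l ++ [u, q]).head? = some p := by
  induction h with
  | single v hv => omega
  | pre k u v w hu huv hc h ih =>
    by_cases hk1 : k = 1
    · subst hk1
      obtain rfl := h.one
      exact ⟨u, [], single u hu, huv, ⟨by simp [huv], by simp [hu, h.mems.1], trivial⟩, rfl, rfl⟩
    · have hp := h.pos
      obtain ⟨x, l, hx, hxw, hl, hlen, hh⟩ := ih (by omega)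
      refine ⟨x, u :: l, ?_, hxw, ?_, by simp; omega, rfl⟩
      · have := pre _ u v x hu huv hc hx
        rwa [show k - 1 + 1 = k + 1 - 1 by omega] at this
      · rw [List.cons_append]
        revert hl hh
        generalize l ++ [x, w] = m
        intro hl hh
        cases m with
        | nil => simp at hh
        | cons v' m =>
          simp only [List.head?_cons, Option.some.injEq] at hh
          subst hh
          exact hl.cons hu huv (fun w hw hvw _ => h1 u hu v' h.mems.1 w hw huv hvw hc)
  | app k u v w hw hvw hc h ih =>
    obtain ⟨l, hl, hlen, hh, hlast⟩ := h.toList h1 h2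
    rcases List.eq_nil_or_concat l with rfl | ⟨l, v', rfl⟩
    · simp at hh
    · simp only [List.concat_eq_append, List.getLast?_append, List.getLast?_singleton,
        Option.some_or, Option.some.injEq] at hlast hl hlen hh
      subst hlast
      refine ⟨v', l, h, hvw, hl.snoc hw hvw
        (fun u hu huv _ => h2 u hu v' h.mems.2.1 w hw huv hvw hc), ?_, ?_⟩
      · simp at hlen ⊢; omega
      · cases l <;> simpa using hh

theorem Pth.toListStart (h1 : ∀ u ∈ S, ∀ v ∈ S, ∀ w ∈ S, u < v → v < w → c u v → cup u v w)
    (h2 : ∀ u ∈ S, ∀ v ∈ S, ∀ w ∈ S, u < v → v < w → ¬ c v w → cup u v w)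
    {k : ℕ} {q s : α} (h : Pth S c k q s) (hk : 2 ≤ k) :
    ∃ v l, Pth S c (k - 1) v s ∧ q < v ∧ CupL S cup (q :: v :: l) ∧ l.length + 2 = k ∧
      (q :: v :: l).getLast? = some s := by
  induction h with
  | single v hv => omega
  | app k u v w hw hvw hc h ih =>
    by_cases hk1 : k = 1
    · subst hk1
      obtain rfl := h.one
      exact ⟨w, [], single w hw, hvw, ⟨by simp [hvw], by simp [hw, h.mems.1], trivial⟩, rfl, rfl⟩
    · have hp := h.pos
      obtain ⟨x, l, hx, hxw, hl, hlen, hh⟩ := ih (by omega)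
      refine ⟨x, l ++ [w], ?_, hxw, ?_, by simp; omega, by simp [List.getLast?_cons]⟩
      · have := app _ x v w hw hvw hc hx
        rwa [show k - 1 + 1 = k + 1 - 1 by omega] at this
      · rw [← List.cons_append, ← List.cons_append]
        revert hl hh
        generalize u :: x :: l = m
        intro hl hh
        rcases List.eq_nil_or_concat m with rfl | ⟨m, v', rfl⟩
        · simp at hh
        · simp only [List.concat_eq_append, List.getLast?_append, List.getLast?_singleton,
            Option.some_or, Option.some.injEq] at hh hl
          subst hh
          have := hl.snoc hw hvw (fun u hu huv _ => h2 u hu v' h.mems.2.1 w hw huv hvw hc)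
          simpa using this
  | pre k u v w hu huv hc h ih =>
    obtain ⟨l, hl, hlen, hh, hlast⟩ := h.toList h1 h2
    cases l with
    | nil => simp at hh
    | cons v' l =>
      simp only [List.head?_cons, Option.some.injEq] at hh
      subst hh
      refine ⟨v', l, h, huv,
        hl.cons hu huv (fun w hw hvw _ => h1 u hu v' h.mems.1 w hw huv hvw hc), ?_, ?_⟩
      · simp at hlen ⊢; omega
      · rw [List.getLast?_cons_cons]; exact hlast

end paths

theorem exists_concat_of_getLast? {l : List α} {v : α} (h : l.getLast? = some v) :
    ∃ m, l = m ++ [v] := by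
  rcases List.eq_nil_or_concat l with rfl | ⟨m, w, rfl⟩
  · simp at h
  · simp at h
    exact ⟨m, by simp [h]⟩

theorem exists_cons_of_head? {l : List α} {v : α} (h : l.head? = some v) :
    ∃ m, l = v :: m := by
  cases l with
  | nil => simp at h
  | cons w m => simp at h; exact ⟨m, by simp [h]⟩

theorem stmt16 (n : ℕ) (hn : 3 ≤ n) (S : Finset α) (cup : α → α → α → Prop)
    (hcard : S.card = Nat.choose (n - 1) 2 + 2) :
    (∃ l : List α, IsCapIn S cup l ∧ l.length = 4) ∨
    (∃ l : List α, IsCupIn S cup l ∧ l.length = n) ∨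
    HasWeakGon S cup 3 (n - 1) := by
  classical
  by_contra hcon
  push Not at hcon
  obtain ⟨hcap, hcup, hgon⟩ := hcon
  obtain ⟨m, rfl⟩ : ∃ m, n = m + 3 := ⟨n - 3, by omega⟩
  -- no long cups
  have noCup : ∀ l, CupL S cup l → ¬ m + 3 ≤ l.length := by
    intro l hl hlen
    have ht := hl.take (m + 3)
    have hlen' : (l.take (m + 3)).length = m + 3 := by simp; omega
    refine hcup (l.take (m + 3)) ⟨?_, ht.1, ht.2.1, ht.2.2⟩ hlen'
    intro h0
    rw [h0] at hlen'
    simp at hlen'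
  have noCap : ∀ x ∈ S, ∀ y ∈ S, ∀ z ∈ S, ∀ w ∈ S, x < y → y < z → z < w →
      ¬ cup x y z → cup y z w := by
    intro x hx y hy z hz w hw hxy hyz hzw h1
    by_contra h2
    refine hcap [x, y, z, w] ⟨by simp, ?_, ?_, h1, h2, trivial⟩ rfl
    · show List.IsChain _ _
      simp [hxy, hyz, hzw]
    · simp [hx, hy, hz, hw]
  let c : α → α → Prop := fun y z => ∃ x ∈ S, x < y ∧ ¬ cup x y z
  have h1 : ∀ u ∈ S, ∀ v ∈ S, ∀ w ∈ S, u < v → v < w → c u v → cup u v w := by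
    rintro u hu v hv w hw huv hvw ⟨x, hx, hxu, hxc⟩
    exact noCap x hx u hu v hv w hw hxu huv hvw hxc
  have h2 : ∀ u ∈ S, ∀ v ∈ S, ∀ w ∈ S, u < v → v < w → ¬ c v w → cup u v w := by
    intro u hu v hv w hw huv hvw hc
    by_contra h
    exact hc ⟨u, hu, huv, h⟩
  have noGon : ∀ p r, Pth S c (m + 2) p r → ∀ q ∈ S, p < q → q < r → cup p q r := by
    intro p r h q hq hpq hqr
    by_contra hc
    obtain ⟨l, hl, hlen, hh, hlast⟩ := h.toList h1 h2
    refine hgon ⟨[p, q, r], l, p, r, ⟨by simp, ?_, ?_, hc, trivial⟩, rfl,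
      ⟨?_, hl.1, hl.2.1, hl.2.2⟩, by omega, rfl, hh, rfl, hlast⟩
    · show List.IsChain _ _
      simp [hpq, hqr]
    · simp [h.mems.1, hq, h.mems.2.1]
    · rintro rfl
      simp at hh
  have hfree : ∀ u v, ¬ Pth S c (m + 3) u v := by
    intro u v h
    obtain ⟨l, hl, hlen, _⟩ := h.toList h1 h2
    exact noCup l hl hlen.ge
  obtain ⟨p, q, r, s, x, y, z, w, i, j, i', j', hpq, hqr, hrs, C1, C2, Cp, Cr, hij, Cq, Cs, hij'⟩ :=
    main_model m α S c hfree (by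
      rw [show m + 3 - 1 = m + 2 by omega] at hcard
      omega)
  have hpS := C1.mems.1
  have hqS := C2.mems.1
  have hrS := C1.mems.2.1
  have hsS := C2.mems.2.1
  have cpq : ¬ c p q := fun h => hfree _ _ (Pth.pre _ p q s hpS hpq h C2)
  have crs : c r s := by
    by_contra h
    exact hfree _ _ (Pth.app _ p r s hsS hrs h C1)
  rcases hqr.eq_or_lt with rfl | hqr
  · obtain ⟨u, l, hu, huq, hl, hlen, hh⟩ := C1.toListEnd h1 h2 (by omega)
    obtain ⟨v, l', hv, hqv, hl', hlen', hlast⟩ := C2.toListStart h1 h2 (by omega)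
    have huS := hu.mems.2.1
    have hvS := hv.mems.1
    by_cases hcuv : c u v
    · have P : Pth S c (m + 2) u s := Pth.pre _ u v s huS (huq.trans hqv) hcuv hv
      have hc := noGon u s P q hqS huq hrs
      have hl2 : CupL S cup ((l ++ [u]) ++ [q]) := by simpa using hl
      have := hl2.snoc hsS hrs (by
        intro u' _ _ h
        simp at h
        subst h
        exact hc)
      apply noCup _ this
      simp; omega
    · have P : Pth S c (m + 2) p v := Pth.app _ p u v hvS (huq.trans hqv) hcuv hu
      have hc := noGon p v P q hqS hpq hqv
      have := hl'.cons hpS hpq (by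
        intro v' _ _ h
        simp at h
        subst h
        exact hc)
      apply noCup _ this
      simp; omega
  · have cpqr : cup p q r := noGon p r C1 q hqS hpq hqr
    have cqrs : cup q r s := noGon q s C2 r hrS hqr hrs
    by_cases hall : ∀ t ∈ S, t < q → cup t q r
    · obtain ⟨L, hL, hLlen, _, hLlast⟩ := Cq.toList h1 h2
      obtain ⟨L', hL', hLlen', hLhead', _⟩ := Cs.toList h1 h2
      obtain ⟨M, rfl⟩ := exists_concat_of_getLast? hLlast
      obtain ⟨M', rfl⟩ := exists_cons_of_head? hLhead'
      have e1 : CupL S cup (M ++ [q, r]) := hL.snoc hrS hqr (fun t ht htq _ => hall t ht htq)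
      have e2 : CupL S cup (r :: s :: M') :=
        hL'.cons hrS hrs (fun t ht hst _ => h1 r hrS s hsS t ht hrs hst crs)
      have e3 : CupL S cup (q :: r :: s :: M') := e2.cons hqS hqr (by
        intro t _ _ h
        simp at h
        subst h
        exact cqrs)
      apply noCup _ (e1.glue e3)
      simp at hLlen hLlen' ⊢; omega
    · push Not at hall
      obtain ⟨t, ht, htq, htc⟩ := hall
      have hall' : ∀ y ∈ S, r < y → cup q r y := fun y hy hry =>
        noCap t ht q hqS r hrS y hy htq hqr hry htc
      obtain ⟨L, hL, hLlen, _, hLlast⟩ := Cp.toList h1 h2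
      obtain ⟨L', hL', hLlen', hLhead', _⟩ := Cr.toList h1 h2
      obtain ⟨M, rfl⟩ := exists_concat_of_getLast? hLlast
      obtain ⟨M', rfl⟩ := exists_cons_of_head? hLhead'
      have e1 : CupL S cup (M ++ [p, q]) :=
        hL.snoc hqS hpq (fun t ht htp _ => h2 t ht p hpS q hqS htp hpq cpq)
      have e2 : CupL S cup (q :: r :: M') := hL'.cons hqS hqr (fun t ht hrt _ => hall' t ht hrt)
      have e3 : CupL S cup (p :: q :: r :: M') := e2.cons hpS hpq (by
        intro t _ _ h
        simp at h
        subst h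
        exact cpqr)
      apply noCup _ (e1.glue e3)
      simp at hLlen hLlen' ⊢; omega
end
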